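/- For every τ in the upper half-plane H, with q = e^{2πiτ}, one has the eta-quotient identity ℘̃a(τ, 2τ) = Π_{n=1}^{∞} (1−q^{n})^{8} / (1−q^{2n})^{4} (i.e. ℘̃a(τ,2τ) = η(τ)^{8} η(2τ)^{−4}). -/

import Mathlib

open Complex

/-- The normalized Weierstrass function
`℘a(z,τ) = π⁻² (1/z² + Σ_{ω ∈ Λ_τ, ω ≠ 0} (1/(z-ω)² − 1/ω²))`, where `Λ_τ = ℤ + τℤ`. -/
noncomputable def wpa (z τ : ℂ) : ℂ :=
  (Real.pi : ℂ)⁻¹ ^ 2 * (1 / z ^ 2 +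
    ∑' p : ℤ × ℤ, if p = 0 then 0 else
      (1 / (z - ((p.1 : ℂ) + (p.2 : ℂ) * τ)) ^ 2 - 1 / ((p.1 : ℂ) + (p.2 : ℂ) * τ) ^ 2))

/-- The renormalized function
`℘̃a(z,τ) = π⁻² Σ_{(n,m)∈ℤ²} (1/(z+(n+1/2)+(m+1/2)τ)² − 1/((n+1/2)+(m+1/2)τ)²)`. -/
noncomputable def wpt (z τ : ℂ) : ℂ :=
  (Real.pi : ℂ)⁻¹ ^ 2 *
    ∑' p : ℤ × ℤ,
      (1 / (z + ((p.1 : ℂ) + 1 / 2) + ((p.2 : ℂ) + 1 / 2) * τ) ^ 2 -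
        1 / (((p.1 : ℂ) + 1 / 2) + ((p.2 : ℂ) + 1 / 2) * τ) ^ 2)

noncomputable def rB (q : ℂ) (n : ℕ) : ℂ := ∏ j ∈ Finset.range n, (1 + q ^ (j + 1)) / (1 - q ^ (j + 1))

noncomputable def rG (q : ℂ) (k : ℤ) : ℂ := 4 * q ^ k / (1 + q ^ k) ^ 2

lemma prod_Icc_erase (f : ℤ → ℂ) (a b : ℕ) :
    ∏ m ∈ (Finset.Icc (-(a : ℤ)) b).erase 0, f m =
      (∏ j ∈ Finset.range a, f (-((j : ℤ) + 1))) * ∏ j ∈ Finset.range b, f ((j : ℤ) + 1) := by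
  have h : (Finset.Icc (-(a : ℤ)) b).erase 0 =
      (Finset.range a).image (fun j : ℕ => -((j : ℤ) + 1)) ∪
        (Finset.range b).image (fun j : ℕ => ((j : ℤ) + 1)) := by
    ext m
    simp only [Finset.mem_erase, Finset.mem_Icc, Finset.mem_union, Finset.mem_image,
      Finset.mem_range]
    constructor
    · rintro ⟨h0, h1, h2⟩
      rcases lt_or_gt_of_ne h0 with h | h
      · left; exact ⟨(-m - 1).toNat, by omega, by omega⟩
      · right; exact ⟨(m - 1).toNat, by omega, by omega⟩
    · rintro (⟨j, h1, rfl⟩ | ⟨j, h1, rfl⟩) <;> omega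
  rw [h, Finset.prod_union, Finset.prod_image, Finset.prod_image]
  · intro x _ y _ hxy; simpa using hxy
  · intro x _ y _ hxy; simpa using hxy
  · rw [Finset.disjoint_left]
    intro m hm hm'
    simp only [Finset.mem_image, Finset.mem_range] at hm hm'
    obtain ⟨_, _, rfl⟩ := hm
    obtain ⟨_, _, h⟩ := hm'
    omega


lemma zpow_norm_ne {q : ℂ} (hq0 : q ≠ 0) (hq : ‖q‖ < 1) {m : ℤ} (hm : m ≠ 0) : ‖q ^ m‖ ≠ 1 := by
  rw [norm_zpow]
  intro h
  have h1 : 0 < ‖q‖ := norm_pos_iff.mpr hq0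
  rw [zpow_eq_one_iff_right₀ h1.le hq.ne] at h
  exact hm h

lemma one_sub_zpow_ne {q : ℂ} (hq0 : q ≠ 0) (hq : ‖q‖ < 1) {m : ℤ} (hm : m ≠ 0) : 1 - q ^ m ≠ 0 := by
  intro h
  apply zpow_norm_ne hq0 hq hm
  rw [← sub_eq_zero.mp h]; simp

lemma one_add_zpow_ne {q : ℂ} (hq0 : q ≠ 0) (hq : ‖q‖ < 1) (m : ℤ) : 1 + q ^ m ≠ 0 := by
  by_cases hm : m = 0
  · subst hm; norm_num
  intro h
  apply zpow_norm_ne hq0 hq hm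
  rw [← neg_eq_of_add_eq_zero_right h]; simp

lemma prod_odd {q : ℂ} (hq0 : q ≠ 0) (hq : ‖q‖ < 1) (a b : ℕ) :
    ∏ m ∈ (Finset.Icc (-(a : ℤ)) b).erase 0, ((1 + q ^ m) / (1 - q ^ m)) =
      (-1) ^ a * rB q a * rB q b := by
  rw [prod_Icc_erase, rB, rB]
  congr 1
  · have : ((-1 : ℂ)) ^ a = ∏ j ∈ Finset.range a, (-1 : ℂ) := by simp
    rw [this, ← Finset.prod_mul_distrib]
    refine Finset.prod_congr rfl fun j _ => ?_
    have h1 := one_sub_zpow_ne hq0 hq (m := (j : ℤ) + 1) (by omega)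
    have h3 : q ^ (j + 1) ≠ 0 := pow_ne_zero _ hq0
    have h2 : q ^ ((j : ℤ) + 1) = q ^ (j + 1) := by exact_mod_cast zpow_natCast q (j + 1)
    rw [zpow_neg, h2]
    rw [h2] at h1
    have h4 : q ^ (j + 1) - 1 ≠ 0 := by rw [← neg_sub]; exact neg_ne_zero.mpr h1
    have h5 : 1 - (q ^ (j + 1))⁻¹ ≠ 0 := by
      intro h; apply h4; field_simp at h; simpa using h
    rw [div_eq_iff h5]
    field_simp
    ring

lemma fin_id0 {q : ℂ} (hq0 : q ≠ 0) (hq : ‖q‖ < 1) (n : ℕ) :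
    ∏ j ∈ (Finset.Icc (-(n : ℤ)) n).erase 0, (q ^ j - 1) =
      ∑ k ∈ Finset.Icc (-(n : ℤ)) n,
        (∏ j ∈ (Finset.Icc (-(n : ℤ)) n).erase 0, (q ^ k + q ^ j)) *
          ∏ j ∈ (Finset.Icc (-(n : ℤ)) n).erase k, ((-1 - q ^ j) / (q ^ k - q ^ j)) := by
  classical
  set s := Finset.Icc (-(n : ℤ)) n with hs
  have h0 : (0 : ℤ) ∈ s := by simp [hs]
  have hinj : Set.InjOn (fun k : ℤ => q ^ k) s := by
    intro a _ b _ hab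
    by_contra hne
    have := one_sub_zpow_ne hq0 hq (m := a - b) (by omega)
    apply this
    rw [zpow_sub₀ hq0]
    simp only at hab
    rw [hab, div_self (zpow_ne_zero _ hq0), sub_self]
  have key := Lagrange.eq_interpolate (f := ∏ j ∈ s.erase 0, (Polynomial.X + Polynomial.C (q ^ j)))
    hinj (by
      rw [Polynomial.degree_prod]
      simp only [Polynomial.degree_X_add_C, Finset.sum_const, nsmul_eq_mul, mul_one]
      exact_mod_cast Finset.card_erase_lt_of_mem h0)
  have key2 := congrArg (Polynomial.eval (-1)) key
  rw [Lagrange.interpolate_apply, Polynomial.eval_finsetSum, Polynomial.eval_prod] at key2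
  convert key2 using 2 with j hj k hk
  · simp; ring
  · rw [Polynomial.eval_mul, Polynomial.eval_C, Polynomial.eval_prod, Lagrange.basis,
      Polynomial.eval_prod]
    congr 1
    · simp
    · refine Finset.prod_congr rfl fun j _ => ?_
      simp [Lagrange.basisDivisor, div_eq_inv_mul]

lemma fin_id {q : ℂ} (hq0 : q ≠ 0) (hq : ‖q‖ < 1) (n : ℕ) :
    ((rB q n)⁻¹) ^ 2 = ∑ k ∈ Finset.Icc (-(n : ℤ)) n,
      (-1) ^ k * rB q (n + k).toNat * rB q (n - k).toNat * rG q k := by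
  classical
  have h := fin_id0 hq0 hq n
  set s := Finset.Icc (-(n : ℤ)) n with hs
  have h0 : (0 : ℤ) ∈ s := by simp [hs]
  have hP : ∏ j ∈ s.erase 0, (1 + q ^ j) ≠ 0 :=
    Finset.prod_ne_zero_iff.mpr fun j _ => one_add_zpow_ne hq0 hq j
  have hcard : ∀ k ∈ s, ∏ j ∈ s.erase k, (-1 : ℂ) = 1 := by
    intro k hk
    rw [Finset.prod_const, Finset.card_erase_of_mem hk]
    simp only [hs, Int.card_Icc]
    have : (((n : ℤ) + 1 - -(n : ℤ)).toNat - 1) = 2 * n := by omega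
    rw [this, pow_mul]; simp
  -- divide by the product
  have h2 : ∏ j ∈ s.erase 0, ((q ^ j - 1) / (1 + q ^ j)) = (-1) ^ n * ((rB q n)⁻¹) ^ 2 := by
    have := prod_odd hq0 hq n n
    have e : ∏ j ∈ s.erase 0, ((q ^ j - 1) / (1 + q ^ j)) =
        (∏ j ∈ s.erase 0, (-1 : ℂ)) * (∏ j ∈ s.erase 0, ((1 + q ^ j) / (1 - q ^ j)))⁻¹ := by
      rw [← Finset.prod_inv_distrib, ← Finset.prod_mul_distrib]
      refine Finset.prod_congr rfl fun j _ => ?_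
      rw [inv_div]; ring
    rw [e, hcard 0 h0, this]
    have : ((-1 : ℂ) ^ n)⁻¹ = (-1) ^ n := by rw [← inv_pow]; norm_num
    rw [mul_inv, mul_inv, this]; ring
  have h3 : ∀ k ∈ s, (∏ j ∈ s.erase 0, (q ^ k + q ^ j)) *
          ∏ j ∈ s.erase k, ((-1 - q ^ j) / (q ^ k - q ^ j)) =
      (∏ j ∈ s.erase 0, (1 + q ^ j)) *
      (((-1) ^ n) * ((-1) ^ k * rB q (n + k).toNat * rB q (n - k).toNat * rG q k)) := by
    intro k hk
    have hk' : -(n : ℤ) ≤ k ∧ k ≤ n := by simpa [hs] using hk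
    have a1 : (∏ j ∈ s.erase 0, (q ^ k + q ^ j)) * (q ^ k + 1) =
        (∏ j ∈ s.erase k, (q ^ k + q ^ j)) * (2 * q ^ k) := by
      have := Finset.prod_erase_mul s (fun j => q ^ k + q ^ j) h0
      have h' := Finset.prod_erase_mul s (fun j => q ^ k + q ^ j) hk
      simp only [zpow_zero] at this
      rw [this, ← h']; ring
    have a2 : (∏ j ∈ s.erase k, (1 + q ^ j)) * (1 + q ^ k) =
        (∏ j ∈ s.erase 0, (1 + q ^ j)) * 2 := by
      have := Finset.prod_erase_mul s (fun j => 1 + q ^ j) h0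
      have h' := Finset.prod_erase_mul s (fun j => 1 + q ^ j) hk
      simp only [zpow_zero] at this
      rw [h', ← this]; norm_num
    have a3 : ∏ j ∈ s.erase k, ((-1 - q ^ j) / (q ^ k - q ^ j)) =
        (∏ j ∈ s.erase k, (1 + q ^ j)) * ∏ j ∈ s.erase k, (q ^ k - q ^ j)⁻¹ := by
      have : ∏ j ∈ s.erase k, ((-1 - q ^ j) / (q ^ k - q ^ j)) =
          (∏ j ∈ s.erase k, (-1 : ℂ)) * ((∏ j ∈ s.erase k, (1 + q ^ j)) *
            ∏ j ∈ s.erase k, (q ^ k - q ^ j)⁻¹) := by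
        rw [← Finset.prod_mul_distrib, ← Finset.prod_mul_distrib]
        refine Finset.prod_congr rfl fun j _ => ?_
        ring
      rw [this, hcard k hk, one_mul]
    have a4 : (∏ j ∈ s.erase k, (q ^ k + q ^ j)) * ∏ j ∈ s.erase k, (q ^ k - q ^ j)⁻¹ =
        (-1) ^ n * ((-1) ^ k * rB q (n + k).toNat * rB q (n - k).toNat) := by
      have p := prod_odd hq0 hq (n + k).toNat (n - k).toNat
      have hs' : (-1 : ℂ) ^ (n + k).toNat = (-1) ^ n * (-1) ^ k := by
        rw [← zpow_natCast, Int.toNat_of_nonneg (by omega), zpow_add₀ (by norm_num), zpow_natCast]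
      rw [hs'] at p
      rw [← Finset.prod_mul_distrib]
      rw [show (-1 : ℂ) ^ n * ((-1) ^ k * rB q (n + k).toNat * rB q (n - k).toNat) =
        (-1) ^ n * (-1) ^ k * rB q (n + k).toNat * rB q (n - k).toNat by ring, ← p]
      refine Finset.prod_bij (fun j _ => j - k) ?_ ?_ ?_ ?_
      · intro j hj
        simp only [Finset.mem_erase, hs, Finset.mem_Icc] at hj ⊢
        omega
      · intro a _ b _ hab; omega
      · intro m hm
        refine ⟨m + k, ?_, by omega⟩
        simp only [Finset.mem_erase, hs, Finset.mem_Icc] at hm ⊢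
        omega
      · intro j _
        have hk0 : q ^ k ≠ 0 := zpow_ne_zero _ hq0
        have : q ^ j = q ^ k * q ^ (j - k) := by rw [← zpow_add₀ hq0]; congr 1; omega
        rw [this, ← div_eq_mul_inv]
        rw [show q ^ k + q ^ k * q ^ (j - k) = q ^ k * (1 + q ^ (j - k)) by ring,
          show q ^ k - q ^ k * q ^ (j - k) = q ^ k * (1 - q ^ (j - k)) by ring,
          mul_div_mul_left _ _ hk0]
    have hk1 := one_add_zpow_ne hq0 hq k
    have hk2 : q ^ k + 1 ≠ 0 := by rwa [add_comm]
    rw [a3, eq_div_of_mul_eq hk2 a1, eq_div_of_mul_eq hk1 a2]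
    rw [show (-1 : ℂ) ^ n * ((-1) ^ k * rB q (n + k).toNat * rB q (n - k).toNat * rG q k) =
      ((-1 : ℂ) ^ n * ((-1) ^ k * rB q (n + k).toNat * rB q (n - k).toNat)) * rG q k by ring,
      ← a4, rG, add_comm (q ^ k) 1]
    field_simp
    ring
  rw [Finset.sum_congr rfl h3, ← Finset.mul_sum, ← Finset.mul_sum] at h
  rw [Finset.prod_div_distrib, h, mul_div_cancel_left₀ _ hP] at h2
  exact (mul_left_cancel₀ (pow_ne_zero n (by norm_num)) h2).symm
open Filter Topology in
lemma rB_tendsto {q : ℂ} (hq0 : q ≠ 0) (hq : ‖q‖ < 1) :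
    ∃ β : ℂ, β ≠ 0 ∧ Tendsto (rB q) atTop (𝓝 β) ∧
      ∏' n : ℕ, ((1 - q ^ (n + 1)) ^ 8 / (1 - q ^ (2 * (n + 1))) ^ 4) = (β⁻¹) ^ 4 := by
  have hs : Summable fun n : ℕ => ‖q ^ (n + 1)‖ := by
    simpa using (summable_nat_add_iff 1).mpr (summable_geometric_of_lt_one (norm_nonneg _) hq)
  have hs' : Summable fun n : ℕ => ‖-q ^ (n + 1)‖ := by simpa using hs
  have n1 : ∀ n : ℕ, 1 + q ^ (n + 1) ≠ 0 := fun n => by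
    have := one_add_zpow_ne hq0 hq ((n + 1 : ℕ) : ℤ)
    rwa [zpow_natCast] at this
  have n2 : ∀ n : ℕ, 1 + -q ^ (n + 1) ≠ 0 := fun n => by
    have := one_sub_zpow_ne hq0 hq (m := ((n + 1 : ℕ) : ℤ)) (by omega)
    rwa [zpow_natCast, sub_eq_add_neg] at this
  have m1 := (multipliable_one_add_of_summable hs).hasProd
  have m2 := (multipliable_one_add_of_summable hs').hasProd
  have z1 := tprod_one_add_ne_zero_of_summable n1 hs
  have z2 := tprod_one_add_ne_zero_of_summable n2 hs'
  set Q := ∏' n : ℕ, (1 + q ^ (n + 1)) with hQ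
  set P := ∏' n : ℕ, (1 + -q ^ (n + 1)) with hP
  have d := m1.div₀ m2 z2
  refine ⟨Q / P, div_ne_zero z1 z2, ?_, ?_⟩
  · have := d.tendsto_prod_nat
    simpa only [rB, sub_eq_add_neg, ← neg_pow] using! this
  · have d2 := (m2.div₀ m1 z1)
    have d4 := ((d2.mul d2).mul (d2.mul d2)).tprod_eq
    rw [inv_div, show (P / Q) ^ 4 = P / Q * (P / Q) * (P / Q * (P / Q)) by ring, ← d4]
    refine tprod_congr fun n => ?_
    have e : 1 - q ^ (2 * (n + 1)) = (1 + -q ^ (n + 1)) * (1 + q ^ (n + 1)) := by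
      rw [mul_comm 2, pow_mul]; ring
    rw [e]
    have := n1 n
    have := n2 n
    rw [show 1 - q ^ (n + 1) = 1 + -q ^ (n + 1) by ring]
    generalize 1 + -q ^ (n + 1) = a at *
    generalize 1 + q ^ (n + 1) = b at *
    field_simp

lemma rG_neg {q : ℂ} (hq0 : q ≠ 0) (hq : ‖q‖ < 1) (k : ℤ) : rG q (-k) = rG q k := by
  have h1 := one_add_zpow_ne hq0 hq k
  have h2 := one_add_zpow_ne hq0 hq (-k)
  have h3 : q ^ k ≠ 0 := zpow_ne_zero _ hq0
  rw [rG, rG, div_eq_div_iff (pow_ne_zero _ h2) (pow_ne_zero _ h1), zpow_neg]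
  field_simp
  ring

lemma rG_summable {q : ℂ} (hq0 : q ≠ 0) (hq : ‖q‖ < 1) : Summable (rG q) := by
  have hn : Summable fun n : ℕ => rG q n := by
    refine Summable.of_norm_bounded (g := fun n : ℕ => 4 / (1 - ‖q‖) ^ 2 * ‖q‖ ^ n)
      ((summable_geometric_of_lt_one (norm_nonneg _) hq).mul_left _) fun n => ?_
    have hb : 1 - ‖q‖ ≤ ‖1 + q ^ n‖ := by
      rcases Nat.eq_zero_or_pos n with rfl | hn
      · norm_num; linarith [norm_nonneg q]
      · have := norm_sub_le_norm_add (1 : ℂ) (q ^ n)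
        have h2 : ‖q ^ n‖ ≤ ‖q‖ := by
          rw [norm_pow]; exact pow_le_of_le_one (norm_nonneg _) hq.le hn.ne'
        rw [norm_one] at this
        linarith
    have hpos : 0 < 1 - ‖q‖ := by linarith
    rw [rG, zpow_natCast, norm_div, norm_mul, norm_pow, norm_pow, div_mul_eq_mul_div]
    norm_num
    gcongr
  refine Summable.of_nat_of_neg hn ?_
  simpa only [rG_neg hq0 hq] using hn

open Filter Topology in
lemma main_q {q : ℂ} (hq0 : q ≠ 0) (hq : ‖q‖ < 1) :
    ∑' k : ℤ, (-1) ^ k * rG q k =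
      ∏' n : ℕ, ((1 - q ^ (n + 1)) ^ 8 / (1 - q ^ (2 * (n + 1))) ^ 4) := by
  obtain ⟨β, hβ, hB, hprod⟩ := rB_tendsto hq0 hq
  rw [hprod]
  obtain ⟨C, hC⟩ : ∃ C, ∀ n, ‖rB q n‖ ≤ C := by
    obtain ⟨C, hC⟩ := (Metric.isBounded_range_of_tendsto _ hB).exists_norm_le
    exact ⟨C, fun n => hC _ ⟨n, rfl⟩⟩
  have hC0 : 0 ≤ C := (norm_nonneg _).trans (hC 0)
  let F : ℕ → ℤ → ℂ := fun n k => if k ∈ Finset.Icc (-(n : ℤ)) n then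
    (-1) ^ k * rB q (n + k).toNat * rB q (n - k).toNat * rG q k else 0
  have t1 : Tendsto (fun n => ∑' k, F n k) atTop (𝓝 (∑' k, (-1) ^ k * β * β * rG q k)) := by
    refine tendsto_tsum_of_dominated_convergence (bound := fun k => C * C * ‖rG q k‖)
      ((rG_summable hq0 hq).norm.mul_left _) ?_ ?_
    · intro k
      have e1 : Tendsto (fun n : ℕ => ((n : ℤ) + k).toNat) atTop atTop := by
        refine tendsto_atTop.mpr fun b => ?_
        filter_upwards [eventually_ge_atTop (b + k.natAbs)] with n hn
        omega
      have e2 : Tendsto (fun n : ℕ => ((n : ℤ) - k).toNat) atTop atTop := by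
        refine tendsto_atTop.mpr fun b => ?_
        filter_upwards [eventually_ge_atTop (b + k.natAbs)] with n hn
        omega
      have := (((hB.comp e1).const_mul ((-1 : ℂ) ^ k)).mul (hB.comp e2)).mul_const (rG q k)
      refine this.congr' ?_
      filter_upwards [eventually_ge_atTop k.natAbs] with n hn
      have : k ∈ Finset.Icc (-(n : ℤ)) n := by rw [Finset.mem_Icc]; omega
      simp only [F, if_pos this, Function.comp]
    · refine Eventually.of_forall fun n k => ?_
      simp only [F]
      split_ifs
      · rw [norm_mul, norm_mul, norm_mul, norm_zpow, norm_neg, norm_one, one_zpow, one_mul]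
        gcongr <;> exact hC _
      · rw [norm_zero]; positivity
  have t2 : ∀ n, ∑' k, F n k = ((rB q n)⁻¹) ^ 2 := by
    intro n
    rw [fin_id hq0 hq n, tsum_eq_sum (s := Finset.Icc (-(n : ℤ)) n)]
    · exact Finset.sum_congr rfl fun k hk => if_pos hk
    · intro k hk; exact if_neg hk
  simp only [t2] at t1
  have t3 := tendsto_nhds_unique t1 ((hB.inv₀ hβ).pow 2)
  have t4 : ∑' k : ℤ, (-1) ^ k * β * β * rG q k = β ^ 2 * ∑' k : ℤ, (-1) ^ k * rG q k := by
    rw [← tsum_mul_left]; exact tsum_congr fun k => by ring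
  rw [t4] at t3
  have : ∑' k : ℤ, (-1) ^ k * rG q k = (β⁻¹) ^ 2 * (β ^ 2 * ∑' k : ℤ, (-1) ^ k * rG q k) := by
    field_simp
  rw [this, t3]; ring
lemma half_sq_sum : HasSum (fun n : ℤ => 1 / ((n : ℂ) + 1 / 2) ^ 2) ((Real.pi : ℂ) ^ 2) := by
  have h := hasSum_zeta_two
  have he : HasSum (fun n : ℕ => (1 : ℝ) / ((2 * n : ℕ) : ℝ) ^ 2) (Real.pi ^ 2 / 24) := by
    have := h.mul_left (1 / 4)
    convert! this using 1
    · ext n; push_cast; ring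
    · ring
  have hos : Summable (fun n : ℕ => (1 : ℝ) / ((2 * n + 1 : ℕ) : ℝ) ^ 2) :=
    h.summable.comp_injective (i := fun n : ℕ => 2 * n + 1) (fun a b hab => by simpa using hab)
  have ho : HasSum (fun n : ℕ => (1 : ℝ) / ((2 * n + 1 : ℕ) : ℝ) ^ 2) (Real.pi ^ 2 / 8) := by
    have h3 := (he.even_add_odd (f := fun n : ℕ => (1 : ℝ) / (n : ℝ) ^ 2) hos.hasSum).unique h
    have := hos.hasSum
    rwa [show ∑' n : ℕ, (1 : ℝ) / ((2 * n + 1 : ℕ) : ℝ) ^ 2 = Real.pi ^ 2 / 8 by linarith] at this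
  have ho2 : HasSum (fun n : ℕ => 1 / ((n : ℂ) + 1 / 2) ^ 2) ((Real.pi : ℂ) ^ 2 / 2) := by
    have := (Complex.hasSum_ofReal.mpr ho).mul_left 4
    convert! this using 1
    · ext n
      push_cast
      have h1 : (2 * (n : ℂ) + 1) ≠ 0 := by exact_mod_cast (by omega : 2 * n + 1 ≠ 0)
      rw [show (n : ℂ) + 1 / 2 = (2 * n + 1) / 2 by ring]
      field_simp
      norm_num
    · push_cast; ring
  have := HasSum.of_nat_of_neg_add_one (f := fun n : ℤ => 1 / ((n : ℂ) + 1 / 2) ^ 2)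
    (by simpa using ho2) (m' := (Real.pi : ℂ) ^ 2 / 2) (by
      convert! ho2 using 1
      ext n
      push_cast
      rw [show -((n : ℂ) + 1) + 1 / 2 = -(n + 1 / 2) by ring, neg_sq])
  convert! this using 1
  ring

lemma pos_sq_sum {τ : ℂ} (hτ : 0 < τ.im) {k : ℤ} (hk : 0 < k) :
    ∑' n : ℤ, 1 / ((n : ℂ) + 1 / 2 + k * τ) ^ 2 =
      (Real.pi : ℂ) ^ 2 * rG (cexp (2 * Real.pi * I * τ)) k := by
  have him : 0 < ((k : ℂ) * τ + 1 / 2).im := by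
    have : ((k : ℂ) * τ + 1 / 2).im = k * τ.im := by
      simp
    rw [this]
    have : (0 : ℝ) < k := by exact_mod_cast hk
    positivity
  have h := EisensteinSeries.qExpansion_identity (k := 1) le_rfl ⟨_, him⟩
  have he : cexp (2 * Real.pi * I * ((k : ℂ) * τ + 1 / 2)) = -cexp (2 * Real.pi * I * τ) ^ k := by
    rw [← Complex.exp_int_mul, show 2 * Real.pi * I * ((k : ℂ) * τ + 1 / 2) =
      k * (2 * Real.pi * I * τ) + Real.pi * I by ring, Complex.exp_add, Complex.exp_pi_mul_I]
    ring
  have hn : ‖-cexp (2 * Real.pi * I * τ) ^ k‖ < 1 := by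
    rw [← he]; exact UpperHalfPlane.norm_exp_two_pi_I_lt_one ⟨_, him⟩
  simp only [he, pow_one, Nat.reduceAdd, Nat.factorial_one,
    tsum_coe_mul_geometric_of_norm_lt_one hn] at h
  rw [show (fun n : ℤ => 1 / ((n : ℂ) + 1 / 2 + k * τ) ^ 2) =
    fun n : ℤ => 1 / ((k : ℂ) * τ + 1 / 2 + n) ^ 2 by ext n; congr 2; ring]
  rw [h, rG, mul_pow, mul_pow, I_sq, sub_neg_eq_add]
  push_cast
  ring

lemma sq_sum {τ : ℂ} (hτ : 0 < τ.im)
    (hneg : ∀ k, rG (cexp (2 * Real.pi * I * τ)) (-k) =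
      rG (cexp (2 * Real.pi * I * τ)) k) (k : ℤ) :
    ∑' n : ℤ, 1 / ((n : ℂ) + 1 / 2 + k * τ) ^ 2 =
      (Real.pi : ℂ) ^ 2 * rG (cexp (2 * Real.pi * I * τ)) k := by
  rcases lt_trichotomy k 0 with hk | rfl | hk
  · have := pos_sq_sum hτ (k := -k) (by omega)
    rw [hneg] at this
    rw [← this, ← ((Equiv.neg ℤ).trans (Equiv.addRight (-1))).tsum_eq]
    refine tsum_congr fun n => ?_
    simp only [Equiv.trans_apply, Equiv.neg_apply, Equiv.coe_addRight]
    push_cast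
    rw [← neg_sq]
    congr 2
    ring
  · have := half_sq_sum.tsum_eq
    simp only [Int.cast_zero, zero_mul, add_zero, this, rG]
    norm_num
  · exact pos_sq_sum hτ hk

lemma sq_summable (z : ℂ) : Summable fun n : ℤ => 1 / ((n : ℂ) + z) ^ 2 := by
  have := EisensteinSeries.linear_right_summable z 1 (k := 2) le_rfl
  refine this.congr fun n => ?_
  rw [Int.cast_one, one_mul, one_div, add_comm]
  norm_cast

lemma int_hasSum_even_odd {f : ℤ → ℂ} {a b : ℂ} (h0 : HasSum (fun m : ℤ => f (2 * m)) a)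
    (h1 : HasSum (fun m : ℤ => f (2 * m + 1)) b) : HasSum f (a + b) := by
  have i0 : Function.Injective fun m : ℤ => 2 * m := fun a b h => by simpa using h
  have i1 : Function.Injective fun m : ℤ => 2 * m + 1 := fun a b h => by simpa using h
  refine HasSum.add_isCompl ?_ (i0.hasSum_range_iff.mpr h0) (i1.hasSum_range_iff.mpr h1)
  refine ⟨?_, ?_⟩
  · rw [Set.disjoint_left]; rintro _ ⟨a, rfl⟩ ⟨b, hb⟩; simp only at hb; omega
  · rw [codisjoint_iff]; ext m
    simp only [Set.sup_eq_union, Set.mem_union, Set.mem_range, Set.top_eq_univ, Set.mem_univ,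
      iff_true]
    rcases Int.even_or_odd' m with ⟨c, h | h⟩
    · left; exact ⟨c, h.symm⟩
    · right; exact ⟨c, h.symm⟩

lemma int_tsum_even_odd {f : ℤ → ℂ} (hf : Summable f) :
    ∑' m : ℤ, (f (2 * m + 2) - f (2 * m + 1)) = ∑' k : ℤ, (-1) ^ k * f k := by
  have i0 : Function.Injective fun m : ℤ => 2 * m := fun a b h => by simpa using h
  have i1 : Function.Injective fun m : ℤ => 2 * m + 1 := fun a b h => by simpa using h
  have i2 : Function.Injective fun m : ℤ => 2 * m + 2 := fun a b h => by simpa using h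
  have s0 := hf.comp_injective i0
  have s1 := hf.comp_injective i1
  have s2 := hf.comp_injective i2
  have e2 : ∑' m : ℤ, f (2 * m + 2) = ∑' m : ℤ, f (2 * m) := by
    rw [← (Equiv.addRight (1 : ℤ)).tsum_eq (fun m => f (2 * m))]
    refine tsum_congr fun m => ?_
    simp only [Equiv.coe_addRight]
    congr 1
    ring
  have e := Summable.tsum_sub s2 s1
  simp only [Function.comp_def] at e s0 s1
  rw [e, e2]
  have g0 : HasSum (fun m : ℤ => (-1 : ℂ) ^ (2 * m) * f (2 * m)) (∑' m : ℤ, f (2 * m)) := by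
    convert! s0.hasSum using 2 with m
    rw [zpow_mul]; norm_num
  have g1 : HasSum (fun m : ℤ => (-1 : ℂ) ^ (2 * m + 1) * f (2 * m + 1))
      (-∑' m : ℤ, f (2 * m + 1)) := by
    convert! s1.hasSum.neg using 2 with m
    rw [zpow_add₀ (by norm_num), zpow_mul]; norm_num
  rw [sub_eq_add_neg]
  exact (int_hasSum_even_odd (f := fun k : ℤ => (-1 : ℂ) ^ k * f k) g0 g1).tsum_eq.symm

lemma cube_summable {τ : ℂ} (hτ : 0 < τ.im) (c : ℤ) :
    Summable fun p : ℤ × ℤ => (‖(p.1 : ℂ) + 1 / 2 + (2 * p.2 + c) * τ‖⁻¹) ^ 3 := by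
  have him : 0 < (2 * τ).im := by simpa using hτ
  have h := (summable_prod_eisSummand (k := 3) le_rfl ⟨2 * τ, him⟩).norm
  have hi : Function.Injective fun p : ℤ × ℤ => ((2 * p.2 + c, 2 * p.1 + 1) : ℤ × ℤ) := by
    rintro ⟨a, b⟩ ⟨a', b'⟩ h
    simp only [Prod.mk.injEq] at h ⊢
    omega
  refine ((h.comp_injective hi).mul_left 8).congr fun p => ?_
  simp only [Function.comp, EisensteinSeries.eisSummand]
  simp only [Matrix.cons_val_zero, Matrix.cons_val_one]
  rw [norm_zpow, zpow_neg]
  push_cast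
  rw [show (2 * (p.2 : ℂ) + c) * (2 * τ) + (2 * p.1 + 1) =
    2 * ((p.1 : ℂ) + 1 / 2 + (2 * p.2 + c) * τ) by ring, norm_mul]
  rw [Complex.norm_ofNat]
  norm_cast
  rw [mul_pow, mul_inv, inv_pow]
  norm_num
  ring

lemma lat_ne {τ : ℂ} (hτ : 0 < τ.im) (a b : ℤ) : (a : ℂ) + 1 / 2 + b * τ ≠ 0 := by
  intro h
  have h1 := congrArg Complex.im h
  have h2 := congrArg Complex.re h
  have hb : b = 0 := by
    simp at h1
    rcases h1 with h1 | h1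
    · exact_mod_cast h1
    · linarith
  subst hb
  simp at h2
  have : ((2 * a + 1 : ℤ) : ℝ) = 0 := by push_cast; linarith
  have : 2 * a + 1 = 0 := by exact_mod_cast this
  omega

lemma diff_summable {τ : ℂ} (hτ : 0 < τ.im) :
    Summable fun p : ℤ × ℤ => 1 / ((p.1 : ℂ) + 1 / 2 + (2 * p.2 + 2 : ℤ) * τ) ^ 2 -
      1 / ((p.1 : ℂ) + 1 / 2 + (2 * p.2 + 1 : ℤ) * τ) ^ 2 := by
  refine Summable.of_norm_bounded (((cube_summable hτ 2).add (cube_summable hτ 1)).mul_left (2 * ‖τ‖))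
    fun p => ?_
  have ha := lat_ne hτ p.1 (2 * p.2 + 2)
  have hb := lat_ne hτ p.1 (2 * p.2 + 1)
  have hab : (p.1 : ℂ) + 1 / 2 + (2 * p.2 + 2 : ℤ) * τ =
    ((p.1 : ℂ) + 1 / 2 + (2 * p.2 + 1 : ℤ) * τ) + τ := by push_cast; ring
  have ea : (p.1 : ℂ) + 1 / 2 + (2 * p.2 + (2 : ℤ)) * τ =
    (p.1 : ℂ) + 1 / 2 + (2 * p.2 + 2 : ℤ) * τ := by push_cast; ring
  have eb : (p.1 : ℂ) + 1 / 2 + (2 * p.2 + (1 : ℤ)) * τ =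
    (p.1 : ℂ) + 1 / 2 + (2 * p.2 + 1 : ℤ) * τ := by push_cast; ring
  rw [ea, eb]
  generalize (p.1 : ℂ) + 1 / 2 + (2 * p.2 + 2 : ℤ) * τ = a at *
  generalize (p.1 : ℂ) + 1 / 2 + (2 * p.2 + 1 : ℤ) * τ = b at *
  have e : 1 / a ^ 2 - 1 / b ^ 2 = -τ * (a⁻¹ * b⁻¹ ^ 2 + a⁻¹ ^ 2 * b⁻¹) := by
    have : τ = a - b := by rw [hab]; ring
    rw [this]
    field_simp
    ring
  rw [e, norm_mul, norm_neg, mul_comm 2, mul_assoc]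
  gcongr
  refine (norm_add_le _ _).trans ?_
  simp only [norm_mul, norm_pow, norm_inv]
  have hx : 0 ≤ ‖a‖⁻¹ := by positivity
  have hy : 0 ≤ ‖b‖⁻¹ := by positivity
  generalize ‖a‖⁻¹ = x at *
  generalize ‖b‖⁻¹ = y at *
  nlinarith [mul_nonneg (add_nonneg hx hy) (sq_nonneg (x - y)), pow_nonneg hx 3, pow_nonneg hy 3]

/-- With `q = e^{2πiτ}`, `℘̃a(τ, 2τ) = Π_{n≥1} (1−q^n)^8/(1−q^{2n})^4`,
i.e. `℘̃a(τ,2τ) = η(τ)^8 η(2τ)^{−4}`. -/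
theorem wpt_tau_eta_quotient (τ : ℂ) (hτ : 0 < τ.im) :
    wpt τ (2 * τ) =
      ∏' n : ℕ,
        (1 - Complex.exp (2 * Real.pi * Complex.I * τ) ^ (n + 1)) ^ 8 /
          (1 - Complex.exp (2 * Real.pi * Complex.I * τ) ^ (2 * (n + 1))) ^ 4 := by
  have hq0 : cexp (2 * Real.pi * I * τ) ≠ 0 := Complex.exp_ne_zero _
  have hq : ‖cexp (2 * Real.pi * I * τ)‖ < 1 :=
    UpperHalfPlane.norm_exp_two_pi_I_lt_one ⟨τ, hτ⟩
  have hpi : (Real.pi : ℂ) ≠ 0 := by exact_mod_cast Real.pi_ne_zero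
  rw [← main_q hq0 hq, wpt]
  have hd := diff_summable hτ
  have e : ∀ p : ℤ × ℤ,
      (1 / (τ + ((p.1 : ℂ) + 1 / 2) + ((p.2 : ℂ) + 1 / 2) * (2 * τ)) ^ 2 -
        1 / (((p.1 : ℂ) + 1 / 2) + ((p.2 : ℂ) + 1 / 2) * (2 * τ)) ^ 2) =
      1 / ((p.1 : ℂ) + 1 / 2 + (2 * p.2 + 2 : ℤ) * τ) ^ 2 -
      1 / ((p.1 : ℂ) + 1 / 2 + (2 * p.2 + 1 : ℤ) * τ) ^ 2 := by
    intro p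
    push_cast
    congr 3 <;> ring
  have hsw := Summable.tsum_prod ((Equiv.prodComm ℤ ℤ).summable_iff.mpr hd)
  simp only [Function.comp_def] at hsw
  rw [tsum_congr e, ← (Equiv.prodComm ℤ ℤ).tsum_eq, hsw]
  have inner : ∀ m : ℤ, ∑' n : ℤ, (1 / ((n : ℂ) + 1 / 2 + (2 * m + 2 : ℤ) * τ) ^ 2 -
      1 / ((n : ℂ) + 1 / 2 + (2 * m + 1 : ℤ) * τ) ^ 2) =
      (Real.pi : ℂ) ^ 2 * (rG (cexp (2 * Real.pi * I * τ)) (2 * m + 2) -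
        rG (cexp (2 * Real.pi * I * τ)) (2 * m + 1)) := by
    intro m
    rw [Summable.tsum_sub, sq_sum hτ (rG_neg hq0 hq), sq_sum hτ (rG_neg hq0 hq), mul_sub]
    · simpa only [add_assoc] using! sq_summable (1 / 2 + ((2 * m + 2 : ℤ) : ℂ) * τ)
    · simpa only [add_assoc] using! sq_summable (1 / 2 + ((2 * m + 1 : ℤ) : ℂ) * τ)
  simp only [Equiv.prodComm_apply, Prod.swap]
  rw [tsum_congr inner, tsum_mul_left, int_tsum_even_odd (rG_summable hq0 hq)]
  field_simp
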